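/- For any permutation π ∈ S_n with b dividing n, the External Spearman's footrule distance to the identity satisfies d_esp(π, id) ≤ n²/(2b). -/

import Mathlib

/-- Block index (1-based) of 1-based position `i+1` for block size `b`. -/
def blk (b : ℕ) {n : ℕ} (i : Fin n) : ℕ := (i.val + b) / b

/-- External Spearman's footrule metric. -/
def dESP (b : ℕ) {n : ℕ} (π δ : Equiv.Perm (Fin n)) : ℤ :=
  ∑ i : Fin n, |(blk b (π i) : ℤ) - (blk b (δ i) : ℤ)|

theorem two_mul_sum_abs_centered_le (m : ℕ) :
    2 * ∑ j ∈ Finset.range m, |2 * (j : ℤ) + 1 - m| ≤ (m : ℤ) ^ 2 := by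
  induction m using Nat.twoStepInduction with
  | zero => simp
  | one => simp
  | more m ih _ =>
    have hsum : ∑ j ∈ Finset.range (m + 2), |2 * (j : ℤ) + 1 - (m + 2 : ℕ)| =
        ∑ j ∈ Finset.range m, |2 * (j : ℤ) + 1 - m| + 2 * (m + 1) := by
      rw [Finset.sum_range_succ, Finset.sum_range_succ']
      have hfirst : |2 * ((0 : ℕ) : ℤ) + 1 - (m + 2 : ℕ)| = m + 1 := by
        rw [abs_of_nonpos] <;> push_cast <;> linarith
      have hlast : |2 * ((m + 1 : ℕ) : ℤ) + 1 - (m + 2 : ℕ)| = m + 1 := by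
        rw [abs_of_nonneg] <;> push_cast <;> linarith
      have hmid : ∀ j : ℕ, |2 * ((j + 1 : ℕ) : ℤ) + 1 - (m + 2 : ℕ)| = |2 * (j : ℤ) + 1 - m| := by
        intro j
        congr 1
        push_cast
        ring
      rw [hlast, hfirst]
      simp only [hmid]
      ring
    rw [hsum]
    push_cast
    nlinarith

theorem sum_abs_two_mul_blk_sub (m b : ℕ) (hb : 0 < b) :
    ∑ i : Fin (m * b), |2 * (blk b i : ℤ) - (m + 1)| =
      b * ∑ j ∈ Finset.range m, |2 * (j : ℤ) + 1 - m| := by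
  rw [← finProdFinEquiv.sum_comp, Fintype.sum_prod_type, Finset.sum_range, Finset.mul_sum]
  refine Finset.sum_congr rfl fun x _ => ?_
  have hblk : ∀ y : Fin b, blk b (finProdFinEquiv (x, y)) = x + 1 := by
    intro y
    simp [blk, Nat.add_div_right _ hb, Nat.add_mul_div_left _ _ hb, Nat.div_eq_of_lt y.isLt]
  simp only [hblk, Finset.sum_const, Finset.card_univ, Fintype.card_fin, nsmul_eq_mul]
  congr 2
  push_cast
  ring

theorem dESP_one_le_sum_abs (b : ℕ) {n : ℕ} (π : Equiv.Perm (Fin n)) (c : ℤ) :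
    dESP b π 1 ≤ ∑ i : Fin n, |2 * (blk b i : ℤ) - c| := by
  have hle : 2 * dESP b π 1 ≤
      ∑ i : Fin n, (|2 * (blk b (π i) : ℤ) - c| + |2 * (blk b i : ℤ) - c|) := by
    rw [dESP, Finset.mul_sum]
    refine Finset.sum_le_sum fun i _ => ?_
    rw [Equiv.Perm.one_apply]
    grind
  rw [Finset.sum_add_distrib, Equiv.sum_comp π fun i => |2 * (blk b i : ℤ) - c|] at hle
  linarith

theorem dESP_le_max (n b : ℕ) (hb : 0 < b) (hbn : b ∣ n) (π : Equiv.Perm (Fin n)) :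
    (dESP b π 1 : ℚ) ≤ (n : ℚ) ^ 2 / (2 * b) := by
  obtain ⟨m, rfl⟩ := exists_eq_mul_left_of_dvd hbn
  have hsum := (dESP_one_le_sum_abs b π (m + 1)).trans_eq (sum_abs_two_mul_blk_sub m b hb)
  have hle : 2 * dESP b π 1 ≤ b * (m : ℤ) ^ 2 := by
    have := mul_le_mul_of_nonneg_left (two_mul_sum_abs_centered_le m) (Nat.cast_nonneg (α := ℤ) b)
    linarith
  have hleQ : 2 * (dESP b π 1 : ℚ) ≤ b * (m : ℚ) ^ 2 := by exact_mod_cast hle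
  have hbQ : (0 : ℚ) < b := by exact_mod_cast hb
  rw [le_div_iff₀ (by positivity)]
  push_cast
  nlinarith [mul_le_mul_of_nonneg_left hleQ hbQ.le]
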